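/- arXiv:1803.10317 — 9 statements merged into one kernel-verified Lean document; each statement's English description precedes it below -/
import Mathlib

section
/- Let L be a real symmetric n×n matrix and fix z ∈ ℝⁿ. Suppose q(x) = (1/2) xᵀ A x + bᵀ x + c (with A real symmetric, b ∈ ℝⁿ, c ∈ ℝ) satisfies q(z) = 𝓛(z) and q(x) ≥ 𝓛(x) for all x ∈ ℝⁿ. Then A − L is positive semidefinite and q(x) = (1/2) zᵀ L z + zᵀ L (x − z) + (1/2)(x − z)ᵀ A (x − z) for all x ∈ ℝⁿ; that is, every quadratic majorizer of the Laplacian quadratic form arises from the standard construction with L̂ = A ⪰ L. -/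
open Matrix

/-- Every quadratic majorizer `q(x) = (1/2)xᵀAx + bᵀx + c` (with `A`
real symmetric) of the Laplacian quadratic form `𝓛(x) = (1/2)xᵀLx` at the point `z`
(i.e. `q(z) = 𝓛(z)` and `q(x) ≥ 𝓛(x)` for all `x`) arises from the standard
construction: `A − L` is positive semidefinite and
`q(x) = (1/2)zᵀLz + zᵀL(x−z) + (1/2)(x−z)ᵀA(x−z)` for all `x`. -/
theorem quadratic_majorizer_form {n : ℕ} (L : Matrix (Fin n) (Fin n) ℝ)
    (hL : L.IsSymm) (z : Fin n → ℝ)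
    (A : Matrix (Fin n) (Fin n) ℝ) (hA : A.IsSymm) (b : Fin n → ℝ) (c : ℝ)
    (q : (Fin n → ℝ) → ℝ)
    (hq : ∀ x, q x = (1/2) * (x ⬝ᵥ A.mulVec x) + b ⬝ᵥ x + c)
    (hqz : q z = (1/2) * (z ⬝ᵥ L.mulVec z))
    (hmaj : ∀ x, q x ≥ (1/2) * (x ⬝ᵥ L.mulVec x)) :
    (A - L).PosSemidef ∧
    ∀ x, q x = (1/2) * (z ⬝ᵥ L.mulVec z) + z ⬝ᵥ L.mulVec (x - z)
        + (1/2) * ((x - z) ⬝ᵥ A.mulVec (x - z)) := by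
  have symm : ∀ (M : Matrix (Fin n) (Fin n) ℝ), M.IsSymm → ∀ u v : Fin n → ℝ,
      u ⬝ᵥ M.mulVec v = v ⬝ᵥ M.mulVec u := by
    intro M hM u v
    rw [dotProduct_mulVec, ← mulVec_transpose, hM.eq, dotProduct_comm]
  have hz := hqz
  rw [hq] at hz
  have key : ∀ (v : Fin n → ℝ) (t : ℝ),
      0 ≤ t * (z ⬝ᵥ A.mulVec v + b ⬝ᵥ v - z ⬝ᵥ L.mulVec v)
        + t ^ 2 / 2 * (v ⬝ᵥ A.mulVec v - v ⬝ᵥ L.mulVec v) := by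
    intro v t
    have h := hmaj (z + t • v)
    rw [hq] at h
    simp only [mulVec_add, mulVec_smul, dotProduct_add, add_dotProduct, smul_dotProduct,
      dotProduct_smul, smul_eq_mul, symm A hA v z, symm L hL v z] at h
    linarith
  have hh : ∀ v : Fin n → ℝ, 0 ≤ v ⬝ᵥ A.mulVec v - v ⬝ᵥ L.mulVec v := by
    intro v
    have h1 := key v 1
    have h2 := key v (-1)
    linarith
  have hg : ∀ v : Fin n → ℝ, z ⬝ᵥ A.mulVec v + b ⬝ᵥ v - z ⬝ᵥ L.mulVec v = 0 := by
    intro v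
    have h0 := hh v
    have h1 := key v
    generalize z ⬝ᵥ A.mulVec v + b ⬝ᵥ v - z ⬝ᵥ L.mulVec v = g at *
    generalize v ⬝ᵥ A.mulVec v - v ⬝ᵥ L.mulVec v = h at *
    have h2 := h1 (-g / (h + 1))
    have hp : 0 < h + 1 := by linarith
    have e : -g / (h + 1) * g + (-g / (h + 1)) ^ 2 / 2 * h
        = -(g ^ 2 * (h + 2)) / (2 * (h + 1) ^ 2) := by
      field_simp
      ring
    rw [e] at h2
    by_contra hne
    have : 0 < g ^ 2 * (h + 2) := by positivity
    have h3 : -(g ^ 2 * (h + 2)) / (2 * (h + 1) ^ 2) < 0 :=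
      div_neg_of_neg_of_pos (by linarith) (by positivity)
    linarith
  refine ⟨PosSemidef.of_dotProduct_mulVec_nonneg ?_ ?_, ?_⟩
  · change (A - L)ᴴ = A - L
    rw [conjTranspose_eq_transpose_of_trivial, transpose_sub, hA.eq, hL.eq]
  · intro x
    simpa [sub_mulVec, dotProduct_sub] using hh x
  · intro x
    have h := hg (x - z)
    rw [hq]
    simp only [mulVec_sub, dotProduct_sub, sub_dotProduct, symm A hA x z] at h ⊢
    linarith
end

section
/- Let L be a weighted Laplacian matrix of size n×n and let α ∈ ℝⁿ satisfy α_i ≥ 2L_{ii} for i = 1, …, n. Then for every z ∈ ℝⁿ, zᵀ(diag(α) − L)z ≥ |z|ᵀ L |z| ≥ 0, where |z| denotes the elementwise absolute value of z. In particular, diag(α) − L is positive semidefinite, i.e., diag(α) ⪰ L. -/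
open Matrix

theorem laplacian_quad_nonneg {n : ℕ} (L : Matrix (Fin n) (Fin n) ℝ)
    (hsym : L.IsSymm) (hoff : ∀ i j, i ≠ j → L i j ≤ 0)
    (hrow : L.mulVec (fun _ => (1 : ℝ)) = 0) (y : Fin n → ℝ) :
    0 ≤ y ⬝ᵥ L.mulVec y := by
  have hr : ∀ i, ∑ j, L i j = 0 := by
    intro i
    have := congrFun hrow i
    simpa [Matrix.mulVec, dotProduct] using this
  have h1 : ∑ i, ∑ j, L i j * (y i) ^ 2 = 0 := by
    simp [← Finset.sum_mul, hr]
  have h2 : ∑ i, ∑ j, L i j * (y j) ^ 2 = 0 := by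
    rw [Finset.sum_comm]
    rw [← h1]
    refine Finset.sum_congr rfl fun i _ => Finset.sum_congr rfl fun j _ => ?_
    rw [hsym.apply i j]
  have h3 : y ⬝ᵥ L.mulVec y = ∑ i, ∑ j, L i j * (y i * y j) := by
    simp only [Matrix.mulVec, dotProduct, Finset.mul_sum]
    refine Finset.sum_congr rfl fun i _ => Finset.sum_congr rfl fun j _ => ?_
    ring
  have h4 : ∑ i, ∑ j, L i j * (y i - y j) ^ 2 ≤ 0 := by
    refine Finset.sum_nonpos fun i _ => Finset.sum_nonpos fun j _ => ?_
    by_cases h : i = j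
    · simp [h]
    · exact mul_nonpos_of_nonpos_of_nonneg (hoff i j h) (sq_nonneg _)
  have h5 : ∑ i, ∑ j, L i j * (y i - y j) ^ 2
      = ∑ i, ∑ j, L i j * (y i) ^ 2 + ∑ i, ∑ j, L i j * (y j) ^ 2
        - 2 * ∑ i, ∑ j, L i j * (y i * y j) := by
    simp only [Finset.mul_sum, ← Finset.sum_add_distrib, ← Finset.sum_sub_distrib]
    refine Finset.sum_congr rfl fun i _ => Finset.sum_congr rfl fun j _ => ?_
    ring
  rw [h3]
  linarith

/-- If `L` is a weighted Laplacian matrix and `α_i ≥ 2L_{ii}` for all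
`i`, then for every `z`, `zᵀ(diag(α) − L)z ≥ |z|ᵀL|z| ≥ 0` (elementwise absolute
value); in particular `diag(α) − L` is positive semidefinite, i.e. `diag(α) ⪰ L`. -/
theorem diag_majorizer_psd {n : ℕ} (L : Matrix (Fin n) (Fin n) ℝ)
    (hsym : L.IsSymm) (hoff : ∀ i j, i ≠ j → L i j ≤ 0)
    (hrow : L.mulVec (fun _ => (1 : ℝ)) = 0)
    (α : Fin n → ℝ) (hα : ∀ i, 2 * L i i ≤ α i) :
    (∀ z : Fin n → ℝ,
      z ⬝ᵥ (Matrix.diagonal α - L).mulVec z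
          ≥ (fun i => |z i|) ⬝ᵥ L.mulVec (fun i => |z i|) ∧
      (fun i => |z i|) ⬝ᵥ L.mulVec (fun i => |z i|) ≥ 0) ∧
    (Matrix.diagonal α - L).PosSemidef := by
  have key : ∀ z : Fin n → ℝ,
      z ⬝ᵥ (Matrix.diagonal α - L).mulVec z
          ≥ (fun i => |z i|) ⬝ᵥ L.mulVec (fun i => |z i|) ∧
      (fun i => |z i|) ⬝ᵥ L.mulVec (fun i => |z i|) ≥ 0 := by
    intro z
    refine ⟨?_, laplacian_quad_nonneg L hsym hoff hrow _⟩
    simp only [Matrix.mulVec, dotProduct, Finset.mul_sum]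
    refine Finset.sum_le_sum fun i _ => Finset.sum_le_sum fun j _ => ?_
    by_cases h : i = j
    · subst h
      simp only [Matrix.sub_apply, Matrix.diagonal_apply_eq]
      have e : |z i| * (L i i * |z i|) = L i i * (z i * z i) := by
        rw [← abs_mul_abs_self (z i)]
        ring
      rw [e]
      nlinarith [mul_nonneg (sub_nonneg.2 (hα i)) (mul_self_nonneg (z i))]
    · simp only [Matrix.sub_apply, Matrix.diagonal_apply_ne _ h]
      have h1 : 0 ≤ |z i| * |z j| + z i * z j := by
        rw [← abs_mul]
        linarith [neg_abs_le (z i * z j)]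
      nlinarith [mul_nonneg (neg_nonneg.2 (hoff i j h)) h1]
  refine ⟨key, Matrix.PosSemidef.of_dotProduct_mulVec_nonneg ?_ fun x => ?_⟩
  · refine (Matrix.isHermitian_diagonal α).sub ?_
    rw [Matrix.IsHermitian, Matrix.conjTranspose_eq_transpose_of_trivial]
    exact hsym
  · have := key x
    simpa using this.2.le.trans this.1
end

section
/- Let f : ℝⁿ → ℝ, let L be a real symmetric positive semidefinite n×n matrix, let L̂ be a real symmetric n×n matrix, and define F(x) = f(x) + (1/2) xᵀ L x. Let z, x⁺ ∈ ℝⁿ, and suppose g ∈ ℝⁿ is a subgradient of f at x⁺ and g + L z + L̂(x⁺ − z) = 0. Then F(z) − F(x⁺) ≥ (z − x⁺)ᵀ (L̂ − L) (z − x⁺). -/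
open Matrix

/-- For `F(x) = f(x) + (1/2)xᵀLx` with `L` real symmetric positive
semidefinite, if `g` is a subgradient of `f` at `x⁺` and `g + Lz + L̂(x⁺ − z) = 0`,
then `F(z) − F(x⁺) ≥ (z − x⁺)ᵀ(L̂ − L)(z − x⁺)`. -/
theorem mm_sufficient_decrease {n : ℕ} (f : (Fin n → ℝ) → ℝ)
    (L Lhat : Matrix (Fin n) (Fin n) ℝ)
    (hLsym : L.IsSymm) (hLpsd : L.PosSemidef) (hLhatsym : Lhat.IsSymm)
    (F : (Fin n → ℝ) → ℝ)
    (hF : ∀ x, F x = f x + (1/2) * (x ⬝ᵥ L.mulVec x))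
    (z xp g : Fin n → ℝ)
    (hg : ∀ y, f y ≥ f xp + g ⬝ᵥ (y - xp))
    (hopt : g + L.mulVec z + Lhat.mulVec (xp - z) = 0) :
    F z - F xp ≥ (z - xp) ⬝ᵥ (Lhat - L).mulVec (z - xp) := by
  have hs : xp ⬝ᵥ L.mulVec z = z ⬝ᵥ L.mulVec xp := by
    rw [Matrix.dotProduct_mulVec, ← Matrix.mulVec_transpose, hLsym.eq, dotProduct_comm]
  have hp : 0 ≤ (z - xp) ⬝ᵥ L.mulVec (z - xp) := by
    simpa using hLpsd.dotProduct_mulVec_nonneg (z - xp)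
  have h1 := hg z
  have h2 : (z - xp) ⬝ᵥ (g + L.mulVec z + Lhat.mulVec (xp - z)) = 0 := by
    rw [hopt, dotProduct_zero]
  rw [dotProduct_comm] at h1
  rw [hF, hF]
  simp only [Matrix.sub_mulVec, Matrix.mulVec_sub, dotProduct_add, dotProduct_sub,
    sub_dotProduct] at *
  linarith
end

section
/- Let f : ℝⁿ → ℝ, let L be a real symmetric positive semidefinite n×n matrix, let L̂ be a real symmetric n×n matrix, and define F(x) = f(x) + (1/2) xᵀ L x. Let z, x⁺ ∈ ℝⁿ, and suppose g ∈ ℝⁿ is a subgradient of f at x⁺ and g + L z + L̂(x⁺ − z) = 0. Then for every y ∈ ℝⁿ, F(y) ≥ F(x⁺) + (y − x⁺)ᵀ (L̂ − L)(z − x⁺); equivalently, F(x⁺) − F(y) ≤ −(z − x⁺)ᵀ (L̂ − L)(y − x⁺). -/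
open Matrix

/-- For `F(x) = f(x) + (1/2)xᵀLx` with `L` real symmetric positive
semidefinite, if `g` is a subgradient of `f` at `x⁺` and `g + Lz + L̂(x⁺ − z) = 0`,
then for every `y`, `F(y) ≥ F(x⁺) + (y − x⁺)ᵀ(L̂ − L)(z − x⁺)`; equivalently
`F(x⁺) − F(y) ≤ −(z − x⁺)ᵀ(L̂ − L)(y − x⁺)`. -/
theorem mm_suboptimality_bound {n : ℕ} (f : (Fin n → ℝ) → ℝ)
    (L Lhat : Matrix (Fin n) (Fin n) ℝ)
    (hLsym : L.IsSymm) (hLpsd : L.PosSemidef) (hLhatsym : Lhat.IsSymm)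
    (F : (Fin n → ℝ) → ℝ)
    (hF : ∀ x, F x = f x + (1/2) * (x ⬝ᵥ L.mulVec x))
    (z xp g : Fin n → ℝ)
    (hg : ∀ y, f y ≥ f xp + g ⬝ᵥ (y - xp))
    (hopt : g + L.mulVec z + Lhat.mulVec (xp - z) = 0) :
    ∀ y : Fin n → ℝ,
      F y ≥ F xp + (y - xp) ⬝ᵥ (Lhat - L).mulVec (z - xp) ∧
      F xp - F y ≤ -((z - xp) ⬝ᵥ (Lhat - L).mulVec (y - xp)) := by
  intro y
  have hsymm : ∀ (M : Matrix (Fin n) (Fin n) ℝ), M.IsSymm → ∀ u v : Fin n → ℝ,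
      u ⬝ᵥ M.mulVec v = v ⬝ᵥ M.mulVec u := by
    intro M hM u v
    rw [Matrix.dotProduct_mulVec, ← Matrix.mulVec_transpose, hM.eq, dotProduct_comm]
  have hDsym : (Lhat - L).IsSymm := hLhatsym.sub hLsym
  have hpsd : 0 ≤ (y - xp) ⬝ᵥ L.mulVec (y - xp) := by
    simpa using hLpsd.dotProduct_mulVec_nonneg (y - xp)
  have h0 : (y - xp) ⬝ᵥ (g + L.mulVec z + Lhat.mulVec (xp - z)) = 0 := by
    rw [hopt, dotProduct_zero]
  have h1 := hg y
  have h2 := hsymm L hLsym xp y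
  rw [dotProduct_comm g] at h1
  have key : F y ≥ F xp + (y - xp) ⬝ᵥ (Lhat - L).mulVec (z - xp) := by
    rw [hF, hF]
    simp only [Matrix.sub_mulVec, Matrix.mulVec_sub, dotProduct_add, dotProduct_sub,
      sub_dotProduct] at *
    linarith
  refine ⟨key, ?_⟩
  rw [hsymm _ hDsym (z - xp) (y - xp)]
  linarith
end

section
/- Let f : ℝⁿ → ℝ be convex, let L be a real symmetric positive semidefinite n×n matrix, let L̂ be a real symmetric n×n matrix with L̂ − L positive definite, and define F(x) = f(x) + (1/2) xᵀ L x. Assume F is bounded below. Let (x^k)_{k≥0} be a sequence in ℝⁿ and (g^k)_{k≥1} a sequence in ℝⁿ such that for every k ≥ 0, g^{k+1} is a subgradient of f at x^{k+1} and g^{k+1} + L x^k + L̂(x^{k+1} − x^k) = 0. Then F(x^{k+1}) ≤ F(x^k) for all k, and x^{k+1} − x^k → 0 as k → ∞. -/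
open Matrix

theorem posDef_coercive {n : ℕ} (M : Matrix (Fin n) (Fin n) ℝ) (hM : M.PosDef) :
    ∃ c : ℝ, 0 < c ∧ ∀ d : Fin n → ℝ, c * ‖d‖ ^ 2 ≤ d ⬝ᵥ M.mulVec d := by
  have hpos : ∀ d : Fin n → ℝ, d ≠ 0 → 0 < d ⬝ᵥ M.mulVec d := by
    intro d hd
    simpa using hM.dotProduct_mulVec_pos hd
  have hcont : Continuous (fun d : Fin n → ℝ => d ⬝ᵥ M.mulVec d) := by fun_prop
  have key : ∃ c : ℝ, 0 < c ∧ ∀ u ∈ Metric.sphere (0 : Fin n → ℝ) 1, c ≤ u ⬝ᵥ M.mulVec u := by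
    rcases (Metric.sphere (0 : Fin n → ℝ) 1).eq_empty_or_nonempty with he | hne
    · exact ⟨1, one_pos, by simp [he]⟩
    · obtain ⟨u, hu, hmin⟩ := (isCompact_sphere (0 : Fin n → ℝ) 1).exists_isMinOn hne
        hcont.continuousOn
      refine ⟨_, hpos u ?_, fun v hv => hmin hv⟩
      rintro rfl
      simp at hu
  obtain ⟨c, hc, h⟩ := key
  refine ⟨c, hc, fun d => ?_⟩
  by_cases hd : d = 0
  · simp [hd]
  have hn : 0 < ‖d‖ := norm_pos_iff.mpr hd
  have h1 := h (‖d‖⁻¹ • d) (by simp [norm_smul, hn.ne'])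
  rw [mulVec_smul, smul_dotProduct, dotProduct_smul, smul_eq_mul, smul_eq_mul] at h1
  have h2 := mul_le_mul_of_nonneg_right h1 (sq_nonneg ‖d‖)
  refine h2.trans (le_of_eq ?_)
  field_simp

/-- For convex `f`, `L` real symmetric positive semidefinite, `L̂`
real symmetric with `L̂ − L` positive definite, and `F(x) = f(x) + (1/2)xᵀLx`
bounded below, if the MM iterates satisfy `g^{k+1} ∈ ∂f(x^{k+1})` and
`g^{k+1} + Lx^k + L̂(x^{k+1} − x^k) = 0`, then `F(x^{k+1}) ≤ F(x^k)` for all `k`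
and `x^{k+1} − x^k → 0` as `k → ∞`. -/
theorem mm_monotone_and_steps_vanish {n : ℕ} (f : (Fin n → ℝ) → ℝ)
    (hf : ConvexOn ℝ Set.univ f)
    (L Lhat : Matrix (Fin n) (Fin n) ℝ)
    (hLsym : L.IsSymm) (hLpsd : L.PosSemidef) (hLhatsym : Lhat.IsSymm)
    (hpd : (Lhat - L).PosDef)
    (F : (Fin n → ℝ) → ℝ)
    (hF : ∀ x, F x = f x + (1/2) * (x ⬝ᵥ L.mulVec x))
    (hbdd : ∃ m : ℝ, ∀ x, m ≤ F x)
    (x : ℕ → Fin n → ℝ) (g : ℕ → Fin n → ℝ)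
    (hg : ∀ k : ℕ, ∀ y, f y ≥ f (x (k+1)) + g (k+1) ⬝ᵥ (y - x (k+1)))
    (hopt : ∀ k : ℕ,
      g (k+1) + L.mulVec (x k) + Lhat.mulVec (x (k+1) - x k) = 0) :
    (∀ k : ℕ, F (x (k+1)) ≤ F (x k)) ∧
    Filter.Tendsto (fun k : ℕ => x (k+1) - x k) Filter.atTop (nhds 0) := by
  have hstep : ∀ k, (x (k+1) - x k) ⬝ᵥ (Lhat - L).mulVec (x (k+1) - x k)
      ≤ F (x k) - F (x (k+1)) := by
    intro k
    have h1 := hg k (x k)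
    have hgk : g (k+1) = -(L.mulVec (x k)) - Lhat.mulVec (x (k+1) - x k) := by
      have := hopt k
      rw [add_assoc] at this
      rw [eq_neg_of_add_eq_zero_left this]
      abel
    have hx1 : x (k+1) = x k + (x (k+1) - x k) := by abel
    have hx2 : x k - x (k+1) = -(x (k+1) - x k) := by abel
    rw [hF, hF]
    rw [hx2, hgk] at h1
    generalize x (k+1) - x k = d at *
    have hq : x (k+1) ⬝ᵥ L.mulVec (x (k+1)) = x k ⬝ᵥ L.mulVec (x k)
        + 2 * (d ⬝ᵥ L.mulVec (x k)) + d ⬝ᵥ L.mulVec d := by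
      have hs : x k ⬝ᵥ L.mulVec d = d ⬝ᵥ L.mulVec (x k) := by
        rw [dotProduct_mulVec, ← mulVec_transpose, hLsym.eq, dotProduct_comm]
      rw [hx1, mulVec_add, add_dotProduct, dotProduct_add, dotProduct_add, hs]
      ring
    have hpsd : 0 ≤ d ⬝ᵥ L.mulVec d := by
      simpa using hLpsd.dotProduct_mulVec_nonneg d
    rw [hq, sub_mulVec, dotProduct_sub]
    rw [dotProduct_neg, sub_dotProduct, neg_dotProduct, dotProduct_comm _ d,
      dotProduct_comm _ d] at h1
    linarith
  obtain ⟨c, hc, hco⟩ := posDef_coercive _ hpd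
  have hmono : ∀ k : ℕ, F (x (k+1)) ≤ F (x k) := fun k => by
    have h1 := hstep k
    have h2 := hco (x (k+1) - x k)
    have h3 : 0 ≤ c * ‖x (k+1) - x k‖ ^ 2 := by positivity
    linarith
  refine ⟨hmono, ?_⟩
  obtain ⟨m, hm⟩ := hbdd
  have hlim := tendsto_atTop_ciInf (antitone_nat_of_succ_le (f := fun k => F (x k)) hmono)
    ⟨m, by rintro _ ⟨k, rfl⟩; exact hm _⟩
  have hdiff := (hlim.sub (hlim.comp (Filter.tendsto_add_atTop_nat 1))).div_const c
  rw [sub_self, zero_div] at hdiff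
  have hsq : Filter.Tendsto (fun k => ‖x (k+1) - x k‖ ^ 2) Filter.atTop (nhds 0) := by
    refine squeeze_zero (fun k => by positivity) (fun k => ?_) hdiff
    rw [le_div_iff₀ hc, mul_comm]
    exact (hco _).trans (hstep k)
  rw [tendsto_zero_iff_norm_tendsto_zero]
  have := hsq.sqrt
  simpa [Real.sqrt_sq] using this
end

section
/- Let f : ℝⁿ → ℝ be convex, let L be a real symmetric positive semidefinite n×n matrix, let L̂ be a real symmetric n×n matrix with L̂ − L positive definite, and define F(x) = f(x) + (1/2) xᵀ L x. Assume F attains its minimum at some x⋆ ∈ ℝⁿ, and that the sublevel set {x ∈ ℝⁿ : F(x) ≤ F(x⁰)} is bounded. Let (x^k)_{k≥0} be a sequence in ℝⁿ starting at x⁰ and (g^k)_{k≥1} a sequence in ℝⁿ such that for every k ≥ 0, g^{k+1} is a subgradient of f at x^{k+1} and g^{k+1} + L x^k + L̂(x^{k+1} − x^k) = 0. Then F(x^k) → F(x⋆) as k → ∞. -/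
open Matrix

/-- For convex `f`, `L` real symmetric positive semidefinite, `L̂`
real symmetric with `L̂ − L` positive definite, and `F(x) = f(x) + (1/2)xᵀLx`
attaining its minimum at `x⋆` with bounded sublevel set `{x : F(x) ≤ F(x⁰)}`, the
MM iterates (with `g^{k+1} ∈ ∂f(x^{k+1})` and `g^{k+1} + Lx^k + L̂(x^{k+1} − x^k) = 0`)
satisfy `F(x^k) → F(x⋆)` as `k → ∞`. -/
theorem mm_objective_converges {n : ℕ} (f : (Fin n → ℝ) → ℝ)
    (hf : ConvexOn ℝ Set.univ f)
    (L Lhat : Matrix (Fin n) (Fin n) ℝ)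
    (hLsym : L.IsSymm) (hLpsd : L.PosSemidef) (hLhatsym : Lhat.IsSymm)
    (hpd : (Lhat - L).PosDef)
    (F : (Fin n → ℝ) → ℝ)
    (hF : ∀ x, F x = f x + (1/2) * (x ⬝ᵥ L.mulVec x))
    (xstar : Fin n → ℝ) (hstar : ∀ y, F xstar ≤ F y)
    (x : ℕ → Fin n → ℝ)
    (hsub : Bornology.IsBounded {y : Fin n → ℝ | F y ≤ F (x 0)})
    (g : ℕ → Fin n → ℝ)
    (hg : ∀ k : ℕ, ∀ y, f y ≥ f (x (k+1)) + g (k+1) ⬝ᵥ (y - x (k+1)))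
    (hopt : ∀ k : ℕ,
      g (k+1) + L.mulVec (x k) + Lhat.mulVec (x (k+1) - x k) = 0) :
    Filter.Tendsto (fun k : ℕ => F (x k)) Filter.atTop (nhds (F xstar)) := by
  have symm : ∀ (M : Matrix (Fin n) (Fin n) ℝ), M.IsSymm → ∀ u v : Fin n → ℝ,
      u ⬝ᵥ M.mulVec v = v ⬝ᵥ M.mulVec u := by
    intro M hM u v
    rw [Matrix.dotProduct_mulVec, ← Matrix.mulVec_transpose, hM.eq, dotProduct_comm]
  have Lnn : ∀ v : Fin n → ℝ, 0 ≤ v ⬝ᵥ L.mulVec v := fun v => by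
    simpa using hLpsd.dotProduct_mulVec_nonneg v
  have Dnn : ∀ v : Fin n → ℝ, 0 ≤ v ⬝ᵥ Lhat.mulVec v - v ⬝ᵥ L.mulVec v := fun v => by
    simpa [Matrix.sub_mulVec, dotProduct_sub] using hpd.posSemidef.dotProduct_mulVec_nonneg v
  let Q : (Fin n → ℝ) → ℝ := fun v => (1/2) * (v ⬝ᵥ Lhat.mulVec v - v ⬝ᵥ L.mulVec v)
  have Qnn : ∀ v, 0 ≤ Q v := fun v => mul_nonneg (by norm_num) (Dnn v)
  have key : ∀ k, F (x (k+1)) - F xstar ≤ Q (xstar - x k) - Q (xstar - x (k+1)) := by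
    intro k
    obtain ⟨d, hd⟩ : ∃ d, d = xstar - x (k+1) := ⟨_, rfl⟩
    obtain ⟨e, he⟩ : ∃ e, e = x (k+1) - x k := ⟨_, rfl⟩
    obtain ⟨p, hp⟩ : ∃ p, p = x (k+1) := ⟨_, rfl⟩
    have h1 : xstar = p + d := by rw [hd, hp]; abel
    have h2 : x k = p - e := by rw [he, hp]; abel
    have h3 : xstar - x k = d + e := by rw [hd, he]; abel
    have hgk := hg k xstar
    have ho := congrArg (fun w => d ⬝ᵥ w) (hopt k)
    rw [← hd, ← hp, dotProduct_comm] at hgk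
    simp only [← hp, h2, dotProduct_add, dotProduct_sub, Matrix.mulVec_sub, dotProduct_zero] at ho
    rw [h3, ← hd, hF, hF, ← hp]
    have q1 : xstar ⬝ᵥ L.mulVec xstar
        = p ⬝ᵥ L.mulVec p + 2 * (d ⬝ᵥ L.mulVec p) + d ⬝ᵥ L.mulVec d := by
      rw [h1]
      simp only [Matrix.mulVec_add, dotProduct_add, add_dotProduct]
      rw [symm L hLsym p d]; ring
    have q2 : Q (d + e) = Q d + Q e + (d ⬝ᵥ Lhat.mulVec e - d ⬝ᵥ L.mulVec e) := by
      simp only [Q, Matrix.mulVec_add, dotProduct_add, add_dotProduct]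
      rw [symm L hLsym e d, symm Lhat hLhatsym e d]; ring
    rw [q1, q2]
    linarith [Lnn d, Qnn e]
  have hsum : Summable (fun k => F (x (k+1)) - F xstar) := by
    refine summable_of_sum_range_le (c := Q (xstar - x 0)) (fun k => sub_nonneg.2 (hstar _)) ?_
    intro m
    calc _ ≤ ∑ k ∈ Finset.range m, (Q (xstar - x k) - Q (xstar - x (k+1))) :=
          Finset.sum_le_sum fun k _ => key k
      _ = Q (xstar - x 0) - Q (xstar - x m) :=
          Finset.sum_range_sub' (fun k => Q (xstar - x k)) m
      _ ≤ _ := by linarith [Qnn (xstar - x m)]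
  rw [← Filter.tendsto_add_atTop_iff_nat 1]
  simpa using hsum.tendsto_atTop_zero.add_const (F xstar)
end

section
/- Let S be a real symmetric positive semidefinite d×d matrix and let κ > 0. Then S + κI is positive definite, θ⋆ = (S + κI)⁻¹ is symmetric positive definite, and for every symmetric positive definite d×d matrix θ, Tr(S θ) − log det θ + κ Tr(θ) ≥ Tr(S θ⋆) − log det θ⋆ + κ Tr(θ⋆), with equality if and only if θ = θ⋆. That is, θ⋆ = (S + κI)⁻¹ is the unique minimizer of the trace-regularized negative log-likelihood over positive definite matrices. -/
open Matrix

/-- For positive definite `M`, `log det M ≤ tr M - d`, with equality only for `M = 1`. -/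
theorem log_det_le_aux {d : ℕ} (M : Matrix (Fin d) (Fin d) ℝ) (hM : M.PosDef) :
    Real.log M.det ≤ M.trace - d ∧ (Real.log M.det = M.trace - d → M = 1) := by
  have hdet : Real.log M.det = ∑ i, Real.log (hM.1.eigenvalues i) := by
    have h := hM.1.det_eq_prod_eigenvalues
    simp only [RCLike.ofReal_real_eq_id, id] at h
    rw [h, Real.log_prod (fun i _ => (hM.eigenvalues_pos i).ne')]
  have htr : M.trace - d = ∑ i, (hM.1.eigenvalues i - 1) := by
    have h := hM.1.trace_eq_sum_eigenvalues
    simp only [RCLike.ofReal_real_eq_id, id] at h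
    rw [h]
    simp
  have hle : ∀ i ∈ Finset.univ, Real.log (hM.1.eigenvalues i) ≤ hM.1.eigenvalues i - 1 :=
    fun i _ => Real.log_le_sub_one_of_pos (hM.eigenvalues_pos i)
  rw [hdet, htr]
  refine ⟨Finset.sum_le_sum hle, fun h => ?_⟩
  rw [Finset.sum_eq_sum_iff_of_le hle] at h
  have h1 : hM.1.eigenvalues = fun _ => 1 := by
    funext i
    by_contra hne
    exact (Real.log_lt_sub_one_of_pos (hM.eigenvalues_pos i) hne).ne (h i (Finset.mem_univ i))
  have hs := hM.1.spectral_theorem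
  rw [h1] at hs
  rw [hs]
  have : (diagonal (RCLike.ofReal ∘ fun _ : Fin d => (1 : ℝ)) : Matrix (Fin d) (Fin d) ℝ) = 1 := by
    ext i j
    simp [diagonal, Matrix.one_apply]
  rw [this, map_one]

/-- The Gaussian log-likelihood bound in terms of `A` and `θ`. -/
theorem log_det_mul_aux {d : ℕ} (A θ : Matrix (Fin d) (Fin d) ℝ) (hA : A.PosDef)
    (hθ : θ.PosDef) :
    Real.log A.det + Real.log θ.det ≤ (A * θ).trace - d ∧
      (Real.log A.det + Real.log θ.det = (A * θ).trace - d → θ = A⁻¹) := by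
  obtain ⟨B, hB⟩ : ∃ B : Matrix (Fin d) (Fin d) ℝ, A = Bᴴ * B := by
    open scoped MatrixOrder in
    exact CStarAlgebra.nonneg_iff_eq_star_mul_self.mp hA.posSemidef.nonneg
  have hAu : IsUnit A.det := (Matrix.isUnit_iff_isUnit_det A).1 hA.isUnit
  have hBu : IsUnit B := by
    rw [Matrix.isUnit_iff_isUnit_det]
    rw [hB, det_mul] at hAu
    exact isUnit_of_mul_isUnit_right hAu
  have hM : (B * θ * Bᴴ).PosDef := (Matrix.IsUnit.posDef_star_right_conjugate_iff hBu).2 hθ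
  have htr : (B * θ * Bᴴ).trace = (A * θ).trace := by
    rw [hB, Matrix.trace_mul_comm, Matrix.mul_assoc]
  have hdet : Real.log (B * θ * Bᴴ).det = Real.log A.det + Real.log θ.det := by
    rw [← Real.log_mul hA.det_pos.ne' hθ.det_pos.ne', hB]
    simp only [det_mul]
    congr 1
    ring
  obtain ⟨h1, h2⟩ := log_det_le_aux _ hM
  rw [hdet, htr] at h1 h2
  refine ⟨h1, fun h => ?_⟩
  have h3 := h2 h
  have h4 : θ * Bᴴ * B = 1 := by
    rw [Matrix.mul_assoc] at h3
    exact mul_eq_one_comm.1 h3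
  rw [Matrix.mul_assoc, ← hB] at h4
  exact (Matrix.inv_eq_left_inv h4).symm

/-- For `S` real symmetric positive semidefinite and `κ > 0`,
`S + κI` is positive definite, `θ⋆ = (S + κI)⁻¹` is symmetric positive definite,
and for every symmetric positive definite `θ`,
`Tr(Sθ) − log det θ + κ Tr(θ) ≥ Tr(Sθ⋆) − log det θ⋆ + κ Tr(θ⋆)`,
with equality iff `θ = θ⋆`: `θ⋆` is the unique minimizer of the trace-regularized
negative log-likelihood over positive definite matrices. -/
theorem trace_regularized_mle {d : ℕ} (S : Matrix (Fin d) (Fin d) ℝ)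
    (hSsym : S.IsSymm) (hSpsd : S.PosSemidef) (κ : ℝ) (hκ : 0 < κ) :
    (S + κ • (1 : Matrix (Fin d) (Fin d) ℝ)).PosDef ∧
    ((S + κ • (1 : Matrix (Fin d) (Fin d) ℝ))⁻¹).IsSymm ∧
    ((S + κ • (1 : Matrix (Fin d) (Fin d) ℝ))⁻¹).PosDef ∧
    ∀ θ : Matrix (Fin d) (Fin d) ℝ, θ.IsSymm → θ.PosDef →
      ((S * θ).trace - Real.log θ.det + κ * θ.trace
          ≥ (S * (S + κ • 1)⁻¹).trace - Real.log ((S + κ • (1 : Matrix (Fin d) (Fin d) ℝ))⁻¹).det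
            + κ * ((S + κ • (1 : Matrix (Fin d) (Fin d) ℝ))⁻¹).trace) ∧
      ((S * θ).trace - Real.log θ.det + κ * θ.trace
          = (S * (S + κ • 1)⁻¹).trace - Real.log ((S + κ • (1 : Matrix (Fin d) (Fin d) ℝ))⁻¹).det
            + κ * ((S + κ • (1 : Matrix (Fin d) (Fin d) ℝ))⁻¹).trace
        ↔ θ = (S + κ • 1)⁻¹) := by
  have hA : (S + κ • (1 : Matrix (Fin d) (Fin d) ℝ)).PosDef :=
    Matrix.PosDef.posSemidef_add hSpsd (Matrix.PosDef.one.smul hκ)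
  have hAi := hA.inv
  refine ⟨hA, ?_, hAi, ?_⟩
  · have h := hAi.1
    rwa [Matrix.IsHermitian, Matrix.conjTranspose_eq_transpose_of_trivial] at h
  intro θ _ hθ
  have key : ∀ X : Matrix (Fin d) (Fin d) ℝ, (S * X).trace + κ * X.trace
      = ((S + κ • (1 : Matrix (Fin d) (Fin d) ℝ)) * X).trace := by
    intro X
    simp [Matrix.add_mul]
  have k1 := key θ
  have k2 := key (S + κ • (1 : Matrix (Fin d) (Fin d) ℝ))⁻¹
  obtain ⟨h1, h2⟩ := log_det_mul_aux _ θ hA hθ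
  have hAu := (Matrix.isUnit_iff_isUnit_det _).1 hA.isUnit
  rw [Matrix.mul_nonsing_inv _ hAu, Matrix.trace_one, Fintype.card_fin] at k2
  have hl : Real.log ((S + κ • (1 : Matrix (Fin d) (Fin d) ℝ))⁻¹).det
      = - Real.log (S + κ • (1 : Matrix (Fin d) (Fin d) ℝ)).det := by
    rw [Matrix.det_nonsing_inv, Ring.inverse_eq_inv', Real.log_inv]
  refine ⟨by linarith, fun h => h2 (by linarith), fun h => by rw [h]⟩
end

section
/- Let M be a real symmetric d×d matrix with eigendecomposition M = Q Λ Qᵀ, where Q is a real orthogonal d×d matrix and Λ is diagonal, and let α > 0. Define the diagonal matrix V with V_{jj} = (−Λ_{jj} + √(Λ_{jj}² + 4α)) / (2α) for j = 1, …, d, and set θ = Q V Qᵀ. Then θ is symmetric positive definite and θ⁻¹ − α θ = M. -/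
open Matrix

/-- Let `M = QΛQᵀ` be real symmetric with `Q` orthogonal and `Λ`
diagonal, and let `α > 0`. With `V` diagonal with entries
`V_jj = (−Λ_jj + √(Λ_jj² + 4α)) / (2α)` and `θ = QVQᵀ`, the matrix `θ` is
symmetric positive definite and solves `θ⁻¹ − αθ = M`. -/
theorem eigen_solution_of_stationarity {d : ℕ}
    (M Q : Matrix (Fin d) (Fin d) ℝ) (lam : Fin d → ℝ)
    (hM : M.IsSymm) (hQ : Qᵀ * Q = 1)
    (hdecomp : M = Q * Matrix.diagonal lam * Qᵀ)
    (α : ℝ) (hα : 0 < α)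
    (θ : Matrix (Fin d) (Fin d) ℝ)
    (hθ : θ = Q * Matrix.diagonal
        (fun j => (-(lam j) + Real.sqrt ((lam j) ^ 2 + 4 * α)) / (2 * α)) * Qᵀ) :
    θ.IsSymm ∧ θ.PosDef ∧ θ⁻¹ - α • θ = M := by
  have hQQt : Q * Qᵀ = 1 := mul_eq_one_comm.mp hQ
  set v : Fin d → ℝ :=
    fun j => (-(lam j) + Real.sqrt ((lam j) ^ 2 + 4 * α)) / (2 * α) with hv
  have hpos : ∀ j, 0 < v j := by
    intro j
    have h : |lam j| < Real.sqrt ((lam j) ^ 2 + 4 * α) := by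
      rw [← Real.sqrt_sq_eq_abs]
      exact Real.sqrt_lt_sqrt (sq_nonneg _) (by linarith)
    have h2 := le_abs_self (lam j)
    exact div_pos (by linarith) (by linarith)
  have hmul : ∀ j, v j * (lam j + α * v j) = 1 := by
    intro j
    have hs : Real.sqrt ((lam j) ^ 2 + 4 * α) ^ 2 = (lam j) ^ 2 + 4 * α :=
      Real.sq_sqrt (by positivity)
    simp only [hv]
    field_simp
    linear_combination hs
  have hsymm : θ.IsSymm := by
    rw [hθ, Matrix.IsSymm]
    simp [Matrix.transpose_mul, Matrix.mul_assoc]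
  have hinv : θ⁻¹ = Q * Matrix.diagonal (fun j => lam j + α * v j) * Qᵀ := by
    apply Matrix.inv_eq_right_inv
    calc θ * (Q * Matrix.diagonal (fun j => lam j + α * v j) * Qᵀ)
        = Q * Matrix.diagonal v * (Qᵀ * Q)
            * Matrix.diagonal (fun j => lam j + α * v j) * Qᵀ := by
          rw [hθ]; simp only [Matrix.mul_assoc]
      _ = Q * (Matrix.diagonal v * Matrix.diagonal (fun j => lam j + α * v j)) * Qᵀ := by
          rw [hQ]; simp only [Matrix.mul_assoc, Matrix.one_mul]
      _ = 1 := by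
          rw [Matrix.diagonal_mul_diagonal]
          simp only [hmul, Matrix.diagonal_one, Matrix.mul_one, hQQt]
  refine ⟨hsymm, ?_, ?_⟩
  · have hD : (Matrix.diagonal v).PosDef := Matrix.PosDef.diagonal hpos
    have h := hD.mul_mul_conjTranspose_same (B := Q) (by
      intro x y hxy
      have := congrArg (fun z => z ᵥ* Qᵀ) hxy
      simpa [Matrix.vecMul_vecMul, hQQt] using this)
    rw [Matrix.conjTranspose_eq_transpose_of_trivial] at h
    rw [hθ]; exact h
  · have hsum : Matrix.diagonal (fun j => lam j + α * v j)
        = Matrix.diagonal lam + α • Matrix.diagonal v := by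
      ext i j
      by_cases hij : i = j
      · subst hij; simp
      · simp [hij]
    rw [hinv, hsum, hdecomp, hθ]
    simp [Matrix.mul_add, Matrix.add_mul]
end

section
/- Let A and B be real symmetric d×d matrices, let α > 0 and κ ∈ ℝ, and suppose θ⋆ is a real symmetric positive definite d×d matrix satisfying the stationarity equation (θ⋆)⁻¹ = A + κI + α(θ⋆ − B). Then θ⋆ is the unique minimizer over symmetric positive definite d×d matrices θ of the function φ(θ) = Tr(A θ) − log det θ + κ Tr(θ) + (α/2) ‖θ − B‖_F², where ‖·‖_F denotes the Frobenius norm. -/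
open Matrix

theorem aux_logdet_le {d : ℕ} (M : Matrix (Fin d) (Fin d) ℝ) (hM : M.PosDef) :
    Real.log M.det ≤ M.trace - d := by
  have h1 := hM.isHermitian.det_eq_prod_eigenvalues
  have h2 := hM.isHermitian.trace_eq_sum_eigenvalues
  simp only [RCLike.ofReal_real_eq_id, id_eq] at h1 h2
  rw [h1, h2, Real.log_prod (fun i _ => (hM.eigenvalues_pos i).ne')]
  calc _ ≤ ∑ i, (hM.isHermitian.eigenvalues i - 1) :=
        Finset.sum_le_sum fun i _ => Real.log_le_sub_one_of_pos (hM.eigenvalues_pos i)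
    _ = _ := by simp

open scoped MatrixOrder Matrix.Norms.L2Operator in
theorem aux_logdet_le_two {d : ℕ} (T S : Matrix (Fin d) (Fin d) ℝ) (hT : T.PosDef)
    (hS : S.PosDef) :
    Real.log T.det - Real.log S.det ≤ (S⁻¹ * T).trace - d := by
  obtain ⟨C, hC⟩ : ∃ C : Matrix (Fin d) (Fin d) ℝ, S⁻¹ = Cᴴ * C :=
    CStarAlgebra.nonneg_iff_eq_star_mul_self.mp hS.inv.posSemidef.nonneg
  have hdet : S⁻¹.det = C.det * C.det := by
    rw [hC, det_mul, det_conjTranspose]; simp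
  have hpos := hS.inv.det_pos
  have hne : C.det ≠ 0 := by
    intro h0
    rw [hdet, h0] at hpos
    simp at hpos
  have hCu : IsUnit C := (Matrix.isUnit_iff_isUnit_det C).mpr (isUnit_iff_ne_zero.mpr hne)
  have hM : (C * T * star C).PosDef := (hCu.posDef_star_right_conjugate_iff).mpr hT
  have h := aux_logdet_le _ hM
  have htr : (C * T * star C).trace = (S⁻¹ * T).trace := by
    rw [hC, trace_mul_comm, ← mul_assoc]; rfl
  have hd : (C * T * star C).det = S⁻¹.det * T.det := by
    rw [hdet, det_mul, det_mul, star_eq_conjTranspose, det_conjTranspose]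
    simp; ring
  rw [htr, hd, Real.log_mul hpos.ne' hT.det_pos.ne', det_nonsing_inv, Ring.inverse_eq_inv',
    Real.log_inv] at h
  linarith

theorem aux_frob {d : ℕ} (M : Matrix (Fin d) (Fin d) ℝ) (hM : Mᵀ = M) :
    ∑ i, ∑ j, (M i j) ^ 2 = (M * M).trace := by
  simp only [trace, diag, mul_apply]
  refine Finset.sum_congr rfl fun i _ => Finset.sum_congr rfl fun j _ => ?_
  have : M j i = M i j := congrFun (congrFun hM i) j
  rw [this, sq]

/-- If the symmetric positive definite matrix `θ⋆` satisfies the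
stationarity equation `(θ⋆)⁻¹ = A + κI + α(θ⋆ − B)` (with `A`, `B` real symmetric
and `α > 0`), then `θ⋆` is the unique minimizer over symmetric positive definite
matrices of `φ(θ) = Tr(Aθ) − log det θ + κ Tr(θ) + (α/2)‖θ − B‖_F²`, where
`‖M‖_F² = Σ_{i,j} M_{ij}²` is the squared Frobenius norm. -/
theorem covariance_update_unique_minimizer {d : ℕ}
    (A B : Matrix (Fin d) (Fin d) ℝ) (hA : A.IsSymm) (hB : B.IsSymm)
    (α : ℝ) (hα : 0 < α) (κ : ℝ)
    (θs : Matrix (Fin d) (Fin d) ℝ) (hθs : θs.PosDef)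
    (hstat : θs⁻¹ = A + κ • (1 : Matrix (Fin d) (Fin d) ℝ) + α • (θs - B))
    (φ : Matrix (Fin d) (Fin d) ℝ → ℝ)
    (hφ : ∀ θ, φ θ = (A * θ).trace - Real.log θ.det + κ * θ.trace
        + (α / 2) * (∑ i, ∑ j, ((θ - B) i j) ^ 2)) :
    (∀ θ : Matrix (Fin d) (Fin d) ℝ, θ.PosDef → φ θs ≤ φ θ) ∧
    (∀ θ : Matrix (Fin d) (Fin d) ℝ, θ.PosDef → φ θ = φ θs → θ = θs) := by
  have hTs : θsᵀ = θs := by simpa using hθs.isHermitian.eq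
  have hBt : Bᵀ = B := hB
  have key : ∀ θ : Matrix (Fin d) (Fin d) ℝ, θ.PosDef →
      φ θs + (α / 2) * (∑ i, ∑ j, ((θ - θs) i j) ^ 2) ≤ φ θ := by
    intro θ hθ
    have hT : θᵀ = θ := by simpa using hθ.isHermitian.eq
    have h := aux_logdet_le_two θ θs hθ hθs
    have hinv : (θs⁻¹ * θs).trace = d := by
      rw [nonsing_inv_mul _ (isUnit_iff_ne_zero.mpr hθs.det_pos.ne')]; simp
    rw [hstat] at h hinv
    rw [hφ, hφ, aux_frob (θ - θs) (by rw [transpose_sub, hT, hTs]),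
      aux_frob (θ - B) (by rw [transpose_sub, hT, hBt]),
      aux_frob (θs - B) (by rw [transpose_sub, hTs, hBt])]
    simp only [add_mul, sub_mul, mul_sub, smul_mul, smul_sub, one_mul, trace_add, trace_sub,
      trace_smul, smul_eq_mul] at h hinv ⊢
    rw [trace_mul_comm θ θs, trace_mul_comm θ B, trace_mul_comm θs B] at *
    linarith
  have hnn : ∀ M : Matrix (Fin d) (Fin d) ℝ, 0 ≤ ∑ i, ∑ j, (M i j) ^ 2 := fun M =>
    Finset.sum_nonneg fun i _ => Finset.sum_nonneg fun j _ => sq_nonneg _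
  refine ⟨fun θ hθ => ?_, fun θ hθ he => ?_⟩
  · have := key θ hθ
    have := mul_nonneg (half_pos hα).le (hnn (θ - θs))
    linarith
  · have h1 := key θ hθ
    have h0 : ∑ i, ∑ j, ((θ - θs) i j) ^ 2 = 0 := by
      have h2 := hnn (θ - θs)
      have h3 := half_pos hα
      by_contra hne
      have := mul_pos h3 (lt_of_le_of_ne h2 (Ne.symm hne))
      linarith
    ext i j
    have h4 := (Finset.sum_eq_zero_iff_of_nonneg
      (fun i _ => Finset.sum_nonneg fun j _ => sq_nonneg ((θ - θs) i j))).mp h0 i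
      (Finset.mem_univ i)
    have h5 := (Finset.sum_eq_zero_iff_of_nonneg
      (fun j _ => sq_nonneg ((θ - θs) i j))).mp h4 j (Finset.mem_univ j)
    have h6 : (θ - θs) i j = 0 := pow_eq_zero_iff (two_ne_zero) |>.mp h5
    rw [Matrix.sub_apply] at h6
    linarith
end
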